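/- Let M > 0, R₀ > 0 and δ > 0. There is a constant C > 0, depending only on M and R₀, such that for every integer j ≥ 1 and every x ∈ ℝ³ with x ≠ 0, |x| ≤ R₀ and |x₃| ≤ M(x₁² + x₂²), one has |∇_x(Φ₀(x, x_j) − Φ₀(x, y_j))| ≤ C/|x|². -/

import Mathlib

noncomputable section

open Real

/-- Euclidean space `ℝ³`. -/
abbrev E3 := EuclideanSpace ℝ (Fin 3)

/-- The fundamental solution `Φ₀(x,y) = 1/(4π|x−y|)` of the Laplacian in `ℝ³`. -/
def Phi0 (x y : E3) : ℝ := 1 / (4 * Real.pi * ‖x - y‖)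

/-- The exterior source points `x_j = (0,0,δ/j)`. -/
def xj (δ : ℝ) (j : ℕ) : E3 := EuclideanSpace.single (2 : Fin 3) (δ / j)

/-- The interior source points `y_j = (0,0,−δ/j)`. -/
def yj (δ : ℝ) (j : ℕ) : E3 := EuclideanSpace.single (2 : Fin 3) (-(δ / j))

theorem differentiableAt_Phi0 {x y : E3} (h : x ≠ y) :
    DifferentiableAt ℝ (fun z => Phi0 z y) x := by
  have hxy : x - y ≠ 0 := sub_ne_zero.mpr h
  have hn : DifferentiableAt ℝ (fun z : E3 => ‖z - y‖) x :=
    (differentiableAt_id.sub_const y).norm ℝ hxy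
  have hpos : 0 < ‖x - y‖ := norm_pos_iff.mpr hxy
  simp only [Phi0, one_div]
  exact (hn.const_mul (4 * Real.pi)).fun_inv (by positivity)

/-- The gradient of `Φ₀(·, y)` is at most `|x - y|⁻²` away from the source point. -/
theorem norm_fderiv_Phi0_le {x y : E3} (h : x ≠ y) :
    ‖fderiv ℝ (fun z => Phi0 z y) x‖ ≤ 1 / ‖x - y‖ ^ 2 := by
  have hxy : x - y ≠ 0 := sub_ne_zero.mpr h
  have hpos : 0 < ‖x - y‖ := norm_pos_iff.mpr hxy
  have hn : DifferentiableAt ℝ (fun z : E3 => ‖z - y‖) x :=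
    (differentiableAt_id.sub_const y).norm ℝ hxy
  have hlip : LipschitzWith 1 (fun z : E3 => ‖z - y‖) :=
    LipschitzWith.of_dist_le_mul fun u v => by
      simpa [dist_eq_norm] using abs_norm_sub_norm_le (u - y) (v - y)
  have hg : ‖fderiv ℝ (fun z : E3 => ‖z - y‖) x‖ ≤ 1 := by
    simpa using norm_fderiv_le_of_lipschitz ℝ hlip (x₀ := x)
  have hd := ((hasDerivAt_inv hpos.ne').comp_hasFDerivAt x hn.hasFDerivAt).const_mul
    (1 / (4 * Real.pi))
  have hfun : (fun z => Phi0 z y) =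
      fun z => 1 / (4 * Real.pi) * (Inv.inv ∘ fun z : E3 => ‖z - y‖) z := by
    funext z
    simp [Phi0, mul_comm]
  rw [hfun, hd.fderiv, norm_smul, norm_smul, norm_neg, norm_inv, norm_pow, norm_norm, one_div,
    norm_inv, Real.norm_of_nonneg (by positivity : 0 ≤ 4 * Real.pi), one_div]
  have hpi : (4 * Real.pi)⁻¹ ≤ 1 := inv_le_one_of_one_le₀ (by linarith [Real.pi_gt_three])
  have hk : (‖x - y‖ ^ 2)⁻¹ * ‖fderiv ℝ (fun z : E3 => ‖z - y‖) x‖ ≤ (‖x - y‖ ^ 2)⁻¹ :=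
    mul_le_of_le_one_right (by positivity) hg
  exact (mul_le_of_le_one_left (by positivity) hpi).trans hk

/-- On the region `|x₃| ≤ M(x₁² + x₂²)`, `|x| ≤ R₀`, the distance from `x` to any point of the
third coordinate axis is comparable to `|x|`. -/
theorem norm_sq_le_mul_norm_sub_single_sq {M R₀ : ℝ} (hM : 0 < M) (hR₀ : 0 < R₀) {x : E3}
    (hxR : ‖x‖ ≤ R₀) (hx : |x 2| ≤ M * ((x 0) ^ 2 + (x 1) ^ 2)) (a : ℝ) :
    ‖x‖ ^ 2 ≤ (1 + M * R₀) * ‖x - EuclideanSpace.single (2 : Fin 3) a‖ ^ 2 := by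
  have h2 : |x 2| ≤ R₀ := (PiLp.norm_apply_le x 2).trans hxR
  have ht : (x 2) ^ 2 ≤ R₀ * (M * ((x 0) ^ 2 + (x 1) ^ 2)) := by
    rw [← sq_abs, sq]
    exact mul_le_mul h2 hx (abs_nonneg _) hR₀.le
  have hp : 0 ≤ (1 + M * R₀) * (x 2 - a) ^ 2 := by positivity
  simp only [EuclideanSpace.norm_sq_eq, Fin.sum_univ_three, Real.norm_eq_abs, sq_abs,
    PiLp.sub_apply, PiLp.single_apply]
  rw [if_neg (by decide), if_neg (by decide), if_pos trivial]
  nlinarith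

theorem differentiableAt_and_norm_fderiv_Phi0_single_le {M R₀ : ℝ} (hM : 0 < M) (hR₀ : 0 < R₀)
    {x : E3} (hx0 : x ≠ 0) (hxR : ‖x‖ ≤ R₀) (hx : |x 2| ≤ M * ((x 0) ^ 2 + (x 1) ^ 2)) (a : ℝ) :
    DifferentiableAt ℝ (fun z => Phi0 z (EuclideanSpace.single 2 a)) x ∧
      ‖fderiv ℝ (fun z => Phi0 z (EuclideanSpace.single 2 a)) x‖ ≤ (1 + M * R₀) / ‖x‖ ^ 2 := by
  have hpos : 0 < ‖x‖ := norm_pos_iff.mpr hx0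
  have hle := norm_sq_le_mul_norm_sub_single_sq hM hR₀ hxR hx a
  have hne : x ≠ EuclideanSpace.single 2 a := by
    intro h
    rw [← h, sub_self, norm_zero] at hle
    nlinarith
  have hd : 0 < ‖x - EuclideanSpace.single 2 a‖ := norm_pos_iff.mpr (sub_ne_zero.mpr hne)
  refine ⟨differentiableAt_Phi0 hne, (norm_fderiv_Phi0_le hne).trans ?_⟩
  rw [div_le_div_iff₀ (by positivity) (by positivity), one_mul]
  exact hle

/-- Let `M > 0`, `R₀ > 0` and `δ > 0`.  There is a constant `C > 0`,
depending only on `M` and `R₀`, such that for every integer `j ≥ 1` and every `x ∈ ℝ³`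
with `x ≠ 0`, `|x| ≤ R₀` and `|x₃| ≤ M(x₁² + x₂²)`, one has
`|∇_x(Φ₀(x, x_j) − Φ₀(x, y_j))| ≤ C/|x|²`. -/
theorem gradient_difference_bound (M R₀ : ℝ) (hM : 0 < M) (hR₀ : 0 < R₀) :
    ∃ C > 0, ∀ δ : ℝ, 0 < δ → ∀ j : ℕ, 1 ≤ j → ∀ x : E3, x ≠ 0 → ‖x‖ ≤ R₀ →
      |x 2| ≤ M * ((x 0) ^ 2 + (x 1) ^ 2) →
      ‖fderiv ℝ (fun z => Phi0 z (xj δ j) - Phi0 z (yj δ j)) x‖ ≤ C / ‖x‖ ^ 2 := by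
  refine ⟨2 * (1 + M * R₀), by positivity, fun δ _ j _ x hx0 hxR hx => ?_⟩
  obtain ⟨hd₁, hb₁⟩ := differentiableAt_and_norm_fderiv_Phi0_single_le hM hR₀ hx0 hxR hx (δ / j)
  obtain ⟨hd₂, hb₂⟩ :=
    differentiableAt_and_norm_fderiv_Phi0_single_le hM hR₀ hx0 hxR hx (-(δ / j))
  unfold xj yj
  rw [fderiv_fun_sub hd₁ hd₂]
  calc _ ≤ _ := norm_sub_le _ _
    _ ≤ (1 + M * R₀) / ‖x‖ ^ 2 + (1 + M * R₀) / ‖x‖ ^ 2 := add_le_add hb₁ hb₂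
    _ = 2 * (1 + M * R₀) / ‖x‖ ^ 2 := by ring
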